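/- Corners of purely infinite simple rings are unital purely infinite simple rings: if R is a purely infinite simple ring and q ∈ R is a nonzero idempotent, then the corner ring qRq = {x ∈ R : q*x*q = x} is a unital ring (with identity q) which is purely infinite simple, i.e. qRq is simple and every nonzero right ideal of qRq contains an idempotent which is infinite in qRq. -/

import Mathlib

/-- `e` is an idempotent. -/
def IsIdem {A : Type*} [Mul A] (e : A) : Prop := e * e = e

/-- Equivalence of idempotents: `p ~ q` iff `∃ x y, x*y = p ∧ y*x = q`. -/
def IdemEquiv {A : Type*} [Mul A] (p q : A) : Prop := ∃ x y : A, x * y = p ∧ y * x = q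

/-- `e` is an infinite idempotent: `e = f + g` with `f, g` orthogonal idempotents,
`e ~ f` and `g ≠ 0`. -/
def IsInfiniteIdem {A : Type*} [NonUnitalRing A] (e : A) : Prop :=
  ∃ f g : A, IsIdem f ∧ IsIdem g ∧ f * g = 0 ∧ g * f = 0 ∧ e = f + g ∧
    IdemEquiv e f ∧ g ≠ 0

/-- `I` is a right ideal of the (possibly non-unital) ring `A`. -/
def IsRightIdealSet {A : Type*} [NonUnitalRing A] (I : Set A) : Prop :=
  (0 : A) ∈ I ∧ (∀ a ∈ I, ∀ b ∈ I, a + b ∈ I) ∧ (∀ a ∈ I, -a ∈ I) ∧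
    (∀ a ∈ I, ∀ r : A, a * r ∈ I)

/-- `I` is a left ideal of the (possibly non-unital) ring `A`. -/
def IsLeftIdealSet {A : Type*} [NonUnitalRing A] (I : Set A) : Prop :=
  (0 : A) ∈ I ∧ (∀ a ∈ I, ∀ b ∈ I, a + b ∈ I) ∧ (∀ a ∈ I, -a ∈ I) ∧
    (∀ a ∈ I, ∀ r : A, r * a ∈ I)

/-- `I` is a two-sided ideal of the (possibly non-unital) ring `A`. -/
def IsTwoSidedIdealSet {A : Type*} [NonUnitalRing A] (I : Set A) : Prop :=
  (0 : A) ∈ I ∧ (∀ a ∈ I, ∀ b ∈ I, a + b ∈ I) ∧ (∀ a ∈ I, -a ∈ I) ∧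
    (∀ a ∈ I, ∀ r : A, a * r ∈ I ∧ r * a ∈ I)

/-- `A` is a simple ring: nonzero, and its only two-sided ideals are `0` and `A`. -/
def RingIsSimple (A : Type*) [NonUnitalRing A] : Prop :=
  (∃ x : A, x ≠ 0) ∧ ∀ I : Set A, IsTwoSidedIdealSet I → I = {0} ∨ I = Set.univ

/-- `A` is purely infinite simple: simple, and every nonzero right ideal contains
an infinite idempotent. -/
def PurelyInfiniteSimple (A : Type*) [NonUnitalRing A] : Prop :=
  RingIsSimple A ∧ ∀ I : Set A, IsRightIdealSet I → (∃ a ∈ I, a ≠ 0) →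
    ∃ e ∈ I, IsInfiniteIdem e

/-- The corner `tRt = {x ∈ R : t*x*t = x}` of an idempotent `t`, as a non-unital
subring of `R`. -/
def corner {A : Type*} [NonUnitalRing A] (t : A) (ht : t * t = t) :
    NonUnitalSubring A where
  carrier := {x | t * x * t = x}
  zero_mem' := by simp
  add_mem' := by
    intro a b ha hb
    simp only [Set.mem_setOf_eq] at *
    rw [mul_add, add_mul, ha, hb]
  neg_mem' := by
    intro a ha
    simp only [Set.mem_setOf_eq] at *
    rw [mul_neg, neg_mul, ha]
  mul_mem' := by
    intro a b ha hb
    simp only [Set.mem_setOf_eq] at *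
    have h1 : t * a = a := by rw [← ha, ← mul_assoc, ← mul_assoc, ht]
    have h2 : b * t = b := by rw [← hb, mul_assoc (t * b) t t, ht]
    rw [← mul_assoc t a b, mul_assoc (t * a) b t, h1, h2]

theorem corner_left {A : Type*} [NonUnitalRing A] {t : A} {ht : t * t = t} {x : A}
    (hx : x ∈ corner t ht) : t * x = x := by
  have h : t * x * t = x := hx
  rw [← h, ← mul_assoc, ← mul_assoc, ht]

theorem corner_right {A : Type*} [NonUnitalRing A] {t : A} {ht : t * t = t} {x : A}
    (hx : x ∈ corner t ht) : x * t = x := by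
  have h : t * x * t = x := hx
  rw [← h, mul_assoc (t * x) t t, ht]

theorem corner_mem {A : Type*} [NonUnitalRing A] {t : A} (ht : t * t = t) {x : A}
    (hx : t * x = x) : x * t ∈ corner t ht := by
  change t * (x * t) * t = x * t
  rw [← mul_assoc, hx, mul_assoc, ht]

theorem corner_sandwich {A : Type*} [NonUnitalRing A] {t : A} (ht : t * t = t) (x : A) :
    t * x * t ∈ corner t ht :=
  corner_mem ht (by rw [← mul_assoc, ht])

theorem corner_simple {R : Type*} [NonUnitalRing R]
    (hR : RingIsSimple R) (q : R) (hq : q * q = q) (hqne : q ≠ 0) :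
    RingIsSimple (corner q hq) := by
  have hqm : q ∈ corner q hq := by change q * q * q = q; rw [hq, hq]
  refine ⟨⟨⟨q, hqm⟩, fun h => hqne (congrArg Subtype.val h)⟩, ?_⟩
  intro J hJ
  obtain ⟨h0, hadd, hneg, hmul⟩ := hJ
  by_cases hz : ∀ a ∈ J, a = 0
  · left
    ext a
    exact ⟨fun h => hz a h, fun h => by rw [Set.mem_singleton_iff.1 h]; exact h0⟩
  right
  push Not at hz
  obtain ⟨a, haJ, ha0⟩ := hz
  let K : Set R := {x | ∀ r s : R, (⟨q * (r * x * s) * q, corner_sandwich hq _⟩ : corner q hq) ∈ J}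
  have hK : IsTwoSidedIdealSet K := by
    refine ⟨?_, ?_, ?_, ?_⟩
    · intro r s
      convert h0 using 1
      ext
      simp
    · intro x hx y hy r s
      convert hadd _ (hx r s) _ (hy r s) using 1
      ext
      simp [mul_add, add_mul]
    · intro x hx r s
      convert hneg _ (hx r s) using 1
      ext
      simp
    · intro x hx u
      refine ⟨fun r s => ?_, fun r s => ?_⟩
      · convert hx r (u * s) using 3
        simp [mul_assoc]
      · convert hx (r * u) s using 3
        simp [mul_assoc]
  have haK : (a : R) ∈ K := by
    intro r s
    convert (hmul _ (hmul a haJ ⟨q * s * q, corner_sandwich hq _⟩).1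
      ⟨q * r * q, corner_sandwich hq _⟩).2 using 1
    ext
    have h1 := corner_left a.2
    have h2 := corner_right a.2
    change q * (r * a * s) * q = q * r * q * (a * (q * s * q))
    calc q * (r * a * s) * q = q * (r * (q * a * q) * s) * q := by rw [h1, h2]
      _ = _ := by simp only [mul_assoc]
  have hKu : K = Set.univ := by
    rcases hR.2 K hK with h | h
    · rw [h] at haK
      exact absurd (Subtype.ext (Set.mem_singleton_iff.1 haK)) ha0
    · exact h
  have hqK : q ∈ K := hKu ▸ Set.mem_univ q
  have hqJ : (⟨q, hqm⟩ : corner q hq) ∈ J := by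
    convert hqK q q using 2
    simp [hq]
  ext x
  simp only [Set.mem_univ, iff_true]
  convert (hmul _ hqJ x).1 using 1
  ext
  exact (corner_left x.2).symm

theorem corner_infinite {R : Type*} [NonUnitalRing R]
    (q : R) (hq : q * q = q) (e : R) (hqe : q * e = e) (he : IsInfiniteIdem e) :
    IsInfiniteIdem (⟨e * q, corner_mem hq hqe⟩ : corner q hq) := by
  obtain ⟨f, g, hf, hg, hfg, hgf, hefg, ⟨x, y, hxy, hyx⟩, hg0⟩ := he
  unfold IsIdem at hf hg
  have hef : e * f = f := by rw [hefg, add_mul, hf, hgf, add_zero]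
  have hfe : f * e = f := by rw [hefg, mul_add, hf, hfg, add_zero]
  have heg : e * g = g := by rw [hefg, add_mul, hg, hfg, zero_add]
  have hge : g * e = g := by rw [hefg, mul_add, hg, hgf, zero_add]
  have hee : e * e = e := by
    conv_lhs => rw [hefg, mul_add, ← hefg, hef, heg]
    exact hefg.symm
  have hqf : q * f = f := by rw [← hef, ← mul_assoc, hqe]
  have hqg : q * g = g := by rw [← heg, ← mul_assoc, hqe]
  have key : ∀ u v : R, q * v = v → u * q * (v * q) = u * v * q := by
    intro u v hv
    rw [mul_assoc u, ← mul_assoc q, hv, mul_assoc]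
  have hqx : q * (e * x * f) = e * x * f := by rw [← mul_assoc, ← mul_assoc, hqe]
  have hqy : q * (f * y * e) = f * y * e := by rw [← mul_assoc, ← mul_assoc, hqf]
  have hxfy : x * f * y = e := by
    rw [← hyx, ← mul_assoc, hxy, mul_assoc, hxy, hee]
  have hyex : y * e * x = f := by
    rw [← hxy, ← mul_assoc, hyx, mul_assoc, hyx, hf]
  have h1 : e * x * f * (f * y * e) = e := by
    calc e * x * f * (f * y * e) = e * (x * (f * f) * y) * e := by simp only [mul_assoc]
      _ = e := by rw [hf, hxfy, hee, hee]
  have h2 : f * y * e * (e * x * f) = f := by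
    calc f * y * e * (e * x * f) = f * (y * (e * e) * x) * f := by simp only [mul_assoc]
      _ = f := by rw [hee, hyex, hf, hf]
  refine ⟨⟨f * q, corner_mem hq hqf⟩, ⟨g * q, corner_mem hq hqg⟩, ?_, ?_, ?_, ?_, ?_,
    ⟨⟨e * x * f * q, corner_mem hq hqx⟩, ⟨f * y * e * q, corner_mem hq hqy⟩, ?_, ?_⟩, ?_⟩
  · apply Subtype.ext
    change f * q * (f * q) = f * q
    rw [key _ _ hqf, hf]
  · apply Subtype.ext
    change g * q * (g * q) = g * q
    rw [key _ _ hqg, hg]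
  · apply Subtype.ext
    change f * q * (g * q) = 0
    rw [key _ _ hqg, hfg, zero_mul]
  · apply Subtype.ext
    change g * q * (f * q) = 0
    rw [key _ _ hqf, hgf, zero_mul]
  · apply Subtype.ext
    change e * q = f * q + g * q
    rw [← add_mul, ← hefg]
  · apply Subtype.ext
    change e * x * f * q * (f * y * e * q) = e * q
    rw [key _ _ hqy, h1]
  · apply Subtype.ext
    change f * y * e * q * (e * x * f * q) = f * q
    rw [key _ _ hqx, h2]
  · intro h
    have h' : g * q = 0 := congrArg Subtype.val h
    apply hg0
    rw [← hge, ← hqe, ← mul_assoc, h', zero_mul]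

/-- Corners of purely infinite simple rings at nonzero idempotents are unital
purely infinite simple rings, with identity the idempotent itself. -/
theorem corner_purelyInfiniteSimple {R : Type*} [NonUnitalRing R]
    (hR : PurelyInfiniteSimple R) (q : R) (hq : q * q = q) (hqne : q ≠ 0) :
    (∃ one : corner q hq, (one : R) = q ∧
        ∀ x : corner q hq, one * x = x ∧ x * one = x) ∧
      PurelyInfiniteSimple (corner q hq) := by
  have hqm : q ∈ corner q hq := by change q * q * q = q; rw [hq, hq]
  refine ⟨⟨⟨q, hqm⟩, rfl, fun x => ⟨Subtype.ext (corner_left x.2),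
    Subtype.ext (corner_right x.2)⟩⟩, corner_simple hR.1 q hq hqne, ?_⟩
  rintro I ⟨-, -, -, hmul⟩ ⟨a, haI, ha0⟩
  have hright : IsRightIdealSet {z : R | ∃ r, z = (a : R) * r} := by
    refine ⟨⟨0, by simp⟩, ?_, ?_, ?_⟩
    · rintro _ ⟨r, rfl⟩ _ ⟨s, rfl⟩
      exact ⟨r + s, by rw [mul_add]⟩
    · rintro _ ⟨r, rfl⟩
      exact ⟨-r, by rw [mul_neg]⟩
    · rintro _ ⟨r, rfl⟩ s
      exact ⟨r * s, by rw [mul_assoc]⟩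
  obtain ⟨e, ⟨r, her⟩, he⟩ := hR.2 _ hright
    ⟨a, ⟨q, (corner_right a.2).symm⟩, fun h => ha0 (Subtype.ext h)⟩
  have hqe : q * e = e := by rw [her, ← mul_assoc, corner_left a.2]
  refine ⟨⟨e * q, corner_mem hq hqe⟩, ?_, corner_infinite q hq e hqe he⟩
  convert hmul a haI ⟨q * r * q, corner_sandwich hq r⟩ using 1
  apply Subtype.ext
  change e * q = a * (q * r * q)
  rw [← mul_assoc, ← mul_assoc, corner_right a.2, her]
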